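/- arXiv:1607.06778 — 4 statements merged into one kernel-verified Lean document; each statement's English description precedes it below -/
import Mathlib

section
/- Let f : ℝ^n → ℝ^n and let F be a real symmetric positive semidefinite n×n matrix such that (x − y)ᵀ(f(x) − f(y)) ≤ (x − y)ᵀ F (x − y) for all x, y ∈ ℝ^n. Let x_1, …, x_N ∈ ℝ^n, set x̄ = (1/N)·Σ_{j=1}^N x_j and e_i = x_i − x̄, and let e ∈ ℝ^{Nn} be the concatenation of e_1, …, e_N. Then (1/N)·Σ_{i=1}^N Σ_{j=1}^N (x_i − x_j)ᵀ f(x_i) ≤ (1/N)·eᵀ (R_N ⊗ F) e. -/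
open Matrix Kronecker

/-- `R_N = N·I_N − 𝟙𝟙ᵀ`: diagonal entries `N − 1`, off-diagonal entries `−1`. -/
def RN (N : ℕ) : Matrix (Fin N) (Fin N) ℝ :=
  Matrix.of fun i j => if i = j then (N : ℝ) - 1 else -1

/-- The quadratic form of a Kronecker product, written blockwise. -/
theorem dotProduct_kronecker_mulVec {ι κ : Type*} [Fintype ι] [Fintype κ]
    (A : Matrix ι ι ℝ) (F : Matrix κ κ ℝ) (e : ι → κ → ℝ) :
    (fun p : ι × κ => e p.1 p.2) ⬝ᵥ (A ⊗ₖ F) *ᵥ (fun p : ι × κ => e p.1 p.2)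
      = ∑ i, ∑ j, A i j * (e i ⬝ᵥ F *ᵥ e j) := by
  simp only [dotProduct, mulVec, Fintype.sum_prod_type, kroneckerMap_apply, Finset.mul_sum]
  refine Finset.sum_congr rfl fun i _ => ?_
  rw [Finset.sum_comm]
  refine Finset.sum_congr rfl fun j _ => Finset.sum_congr rfl fun k _ =>
    Finset.sum_congr rfl fun l _ => ?_
  ring

theorem sum_RN_mul {N : ℕ} (B : Fin N → Fin N → ℝ) :
    ∑ i, ∑ j, RN N i j * B i j = N * ∑ i, B i i - ∑ i, ∑ j, B i j := by
  have h (i j : Fin N) : RN N i j * B i j = (if i = j then N * B i j else 0) - B i j := by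
    simp only [RN, of_apply]
    split_ifs <;> ring
  simp [h, Finset.sum_sub_distrib, Finset.mul_sum]

/-- `eᵀ (R_N ⊗ F) e` is half the sum of the `F`-forms of the pairwise differences. -/
theorem two_mul_dotProduct_RN_kronecker_mulVec {N : ℕ} {κ : Type*} [Fintype κ]
    (F : Matrix κ κ ℝ) (e : Fin N → κ → ℝ) :
    2 * ((fun p : Fin N × κ => e p.1 p.2) ⬝ᵥ (RN N ⊗ₖ F) *ᵥ (fun p : Fin N × κ => e p.1 p.2))
      = ∑ i, ∑ j, (e i - e j) ⬝ᵥ F *ᵥ (e i - e j) := by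
  rw [dotProduct_kronecker_mulVec, sum_RN_mul (fun i j => e i ⬝ᵥ F *ᵥ e j)]
  simp only [mulVec_sub, dotProduct_sub, sub_dotProduct, Finset.sum_sub_distrib,
    Finset.sum_const, Finset.card_univ, Fintype.card_fin, nsmul_eq_mul, ← Finset.mul_sum]
  rw [Finset.sum_comm (f := fun i j => e j ⬝ᵥ F *ᵥ e i)]
  ring

theorem two_mul_sum_sub_dotProduct {ι κ : Type*} [Fintype ι] [Fintype κ] (x g : ι → κ → ℝ) :
    2 * ∑ i, ∑ j, (x i - x j) ⬝ᵥ g i = ∑ i, ∑ j, (x i - x j) ⬝ᵥ (g i - g j) := by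
  have h : ∑ i, ∑ j, (x i - x j) ⬝ᵥ g j = -∑ i, ∑ j, (x i - x j) ⬝ᵥ g i := by
    rw [Finset.sum_comm]
    simp only [← Finset.sum_neg_distrib, ← neg_dotProduct, neg_sub]
  simp only [dotProduct_sub _ (g _), Finset.sum_sub_distrib, h]
  ring

/-- If `f` satisfies the QUAD condition with symmetric positive semidefinite matrix `F`,
then for any `x_1, …, x_N ∈ ℝ^n`, with `e_i = x_i − x̄` (deviations from the average)
stacked into `e ∈ ℝ^{Nn}`:
`(1/N)·Σᵢ Σⱼ (xᵢ − xⱼ)ᵀ f(xᵢ) ≤ (1/N)·eᵀ (R_N ⊗ F) e`. -/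
theorem stmt_4 {N n : ℕ} (f : (Fin n → ℝ) → (Fin n → ℝ))
    (F : Matrix (Fin n) (Fin n) ℝ) (hF : F.PosSemidef)
    (hquad : ∀ x y : Fin n → ℝ, (x - y) ⬝ᵥ (f x - f y) ≤ (x - y) ⬝ᵥ F *ᵥ (x - y))
    (x : Fin N → (Fin n → ℝ)) :
    (1 / (N : ℝ)) * ∑ i, ∑ j, (x i - x j) ⬝ᵥ f (x i)
      ≤ (1 / (N : ℝ)) *
        ((fun p : Fin N × Fin n => (x p.1 - (1 / (N : ℝ)) • ∑ j, x j) p.2) ⬝ᵥ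
          (RN N ⊗ₖ F) *ᵥ
          (fun p : Fin N × Fin n => (x p.1 - (1 / (N : ℝ)) • ∑ j, x j) p.2)) := by
  refine mul_le_mul_of_nonneg_left ?_ (by positivity)
  have hform := two_mul_dotProduct_RN_kronecker_mulVec F
    (fun i => x i - (1 / (N : ℝ)) • ∑ j, x j)
  simp only [sub_sub_sub_cancel_right] at hform
  have hdrift := two_mul_sum_sub_dotProduct x (fun i => f (x i))
  have hle : ∑ i, ∑ j, (x i - x j) ⬝ᵥ (f (x i) - f (x j))
      ≤ ∑ i, ∑ j, (x i - x j) ⬝ᵥ F *ᵥ (x i - x j) :=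
    Finset.sum_le_sum fun i _ => Finset.sum_le_sum fun j _ => hquad (x i) (x j)
  linarith
end

section
/- Let L be a real symmetric positive semidefinite N×N matrix with zero row sums whose kernel is exactly the span of the all-ones vector 𝟙 (the Laplacian of a connected undirected graph). Let F and H be real symmetric n×n matrices and let ρ > 0 be such that F − μ·H + ρ·I_n is negative semidefinite for every nonzero eigenvalue μ of L. Then for all vectors e_1, …, e_N ∈ ℝ^n with Σ_{i=1}^N e_i = 0, one has Σ_{i=1}^N e_iᵀ F e_i − Σ_{i=1}^N Σ_{j=1}^N l_{ij}·e_iᵀ H e_j ≤ −ρ·Σ_{i=1}^N ‖e_i‖². -/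
open Matrix

/-- A real matrix is negative semidefinite if its quadratic form is nonpositive. -/
def IsNegSemidef {k : Type*} [Fintype k] (A : Matrix k k ℝ) : Prop :=
  ∀ x : k → ℝ, x ⬝ᵥ A *ᵥ x ≤ 0

/-- The bilinear form of `A` on rows of `B` gives the entries of `B * A * Bᵀ`. -/
theorem dotProduct_mulVec_row_eq_mul_apply {ι m : Type*} [Fintype m]
    (A : Matrix m m ℝ) (B : Matrix ι m ℝ) (i j : ι) :
    B i ⬝ᵥ A *ᵥ B j = (B * A * Bᵀ) i j := by
  rw [Matrix.mul_assoc]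
  simp only [Matrix.mul_apply, dotProduct, mulVec, transpose_apply]

/-- If `M = U * diagonal d * Uᵀ`, the block form `∑ᵢ ∑ⱼ Mᵢⱼ (eᵢᵀ A eⱼ)` is diagonal in the
transformed vectors `(Uᵀ * e) k`. -/
theorem sum_mul_dotProduct_mulVec_of_eq_diagonal {ι κ m : Type*} [Fintype ι] [Fintype κ]
    [DecidableEq κ] [Fintype m] {M : Matrix ι ι ℝ} {U : Matrix ι κ ℝ} {d : κ → ℝ}
    (hM : M = U * diagonal d * Uᵀ) (A : Matrix m m ℝ) (e : Matrix ι m ℝ) :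
    ∑ i, ∑ j, M i j * (e i ⬝ᵥ A *ᵥ e j) =
      ∑ k, d k * ((Uᵀ * e) k ⬝ᵥ A *ᵥ (Uᵀ * e) k) := by
  have hsymm : Mᵀ = M := by
    simp [hM, Matrix.transpose_mul, Matrix.mul_assoc]
  calc ∑ i, ∑ j, M i j * (e i ⬝ᵥ A *ᵥ e j)
      = trace (M * (e * A * eᵀ)) := by
        simp only [dotProduct_mulVec_row_eq_mul_apply, trace, diag_apply,
          Matrix.mul_apply (M := M)]
        rw [Finset.sum_comm]
        refine Finset.sum_congr rfl fun i _ => Finset.sum_congr rfl fun j _ => ?_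
        rw [← congrFun (congrFun hsymm i) j, transpose_apply]
    _ = trace (diagonal d * ((Uᵀ * e) * A * (Uᵀ * e)ᵀ)) := by
        rw [hM, Matrix.mul_assoc U, Matrix.mul_assoc U, Matrix.trace_mul_comm]
        simp only [Matrix.transpose_mul, Matrix.transpose_transpose, Matrix.mul_assoc]
    _ = ∑ k, d k * ((Uᵀ * e) k ⬝ᵥ A *ᵥ (Uᵀ * e) k) := by
        simp only [dotProduct_mulVec_row_eq_mul_apply, trace, diag_apply, diagonal_mul]

/-- Let `L` be the Laplacian of a connected undirected graph on `N` nodes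
(symmetric positive semidefinite, zero row sums, kernel exactly the span of `𝟙`).
If `F − μ·H + ρ·I` is negative semidefinite for every nonzero eigenvalue `μ` of `L`
(`F`, `H` symmetric, `ρ > 0`), then for all `e_1, …, e_N ∈ ℝ^n` with `Σᵢ eᵢ = 0`,
`Σᵢ eᵢᵀFeᵢ − Σᵢ Σⱼ lᵢⱼ·eᵢᵀHeⱼ ≤ −ρ·Σᵢ ‖eᵢ‖²`. -/
theorem stmt_6 {N n : ℕ} (L : Matrix (Fin N) (Fin N) ℝ)
    (hL : L.PosSemidef) (hrow : ∀ i, ∑ j, L i j = 0)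
    (hker : ∀ v : Fin N → ℝ, L *ᵥ v = 0 ↔ ∃ c : ℝ, v = fun _ => c)
    (F H : Matrix (Fin n) (Fin n) ℝ) (hF : F.IsSymm) (hH : H.IsSymm)
    (ρ : ℝ) (hρ : 0 < ρ)
    (hcond : ∀ μ : ℝ, μ ≠ 0 → (∃ v : Fin N → ℝ, v ≠ 0 ∧ L *ᵥ v = μ • v) →
      IsNegSemidef (F - μ • H + ρ • (1 : Matrix (Fin n) (Fin n) ℝ)))
    (e : Fin N → (Fin n → ℝ)) (hsum : ∑ i, e i = 0) :
    ∑ i, e i ⬝ᵥ F *ᵥ e i - ∑ i, ∑ j, L i j * (e i ⬝ᵥ H *ᵥ e j)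
      ≤ -ρ * ∑ i, e i ⬝ᵥ e i := by
  have hLh := hL.isHermitian
  set U : Matrix (Fin N) (Fin N) ℝ := hLh.eigenvectorUnitary.1
  set d := hLh.eigenvalues
  have hUU : U * Uᵀ = 1 := by
    have := Unitary.coe_mul_star_self hLh.eigenvectorUnitary
    rwa [Unitary.coe_star, star_eq_conjTranspose, conjTranspose_eq_transpose_of_trivial] at this
  have hUU' : Uᵀ * U = 1 := mul_eq_one_comm.mp hUU
  have hLU : L = U * diagonal d * Uᵀ := by
    have := hLh.spectral_theorem
    rwa [Unitary.conjStarAlgAut_apply, star_eq_conjTranspose,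
      conjTranspose_eq_transpose_of_trivial] at this
  have hone : (1 : Matrix (Fin N) (Fin N) ℝ) = U * diagonal (fun _ => 1) * Uᵀ := by
    rw [diagonal_one, Matrix.mul_one, hUU]
  have hsq (A : Matrix (Fin n) (Fin n) ℝ) :
      ∑ i, e i ⬝ᵥ A *ᵥ e i = ∑ k, (Uᵀ * of e) k ⬝ᵥ A *ᵥ (Uᵀ * of e) k := by
    have h := sum_mul_dotProduct_mulVec_of_eq_diagonal hone A (of e)
    simp only [Matrix.one_apply, ite_mul, one_mul, zero_mul, Finset.sum_ite_eq,
      Finset.mem_univ, if_true] at h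
    exact h
  have hHsum := sum_mul_dotProduct_mulVec_of_eq_diagonal hLU H (of e)
  have hnorm := hsq 1
  simp only [one_mulVec] at hnorm
  have heig (k : Fin N) : L *ᵥ (fun i => U i k) = d k • fun i => U i k :=
    hLh.mulVec_eigenvectorBasis k
  have hne (k : Fin N) : (fun i => U i k) ≠ 0 := fun h0 => by
    have h1 := congrFun (congrFun hUU' k) k
    simp [Matrix.mul_apply, fun i => congrFun h0 i] at h1
  have hterm (k : Fin N) : (Uᵀ * of e) k ⬝ᵥ F *ᵥ (Uᵀ * of e) k
      - d k * ((Uᵀ * of e) k ⬝ᵥ H *ᵥ (Uᵀ * of e) k)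
      ≤ -ρ * ((Uᵀ * of e) k ⬝ᵥ (Uᵀ * of e) k) := by
    by_cases hd : d k = 0
    · obtain ⟨c, hc⟩ := (hker fun i => U i k).mp (by rw [heig, hd, zero_smul])
      have hy : (Uᵀ * of e) k = 0 := by
        ext a
        have hs := congrFun hsum a
        simp only [Finset.sum_apply, Pi.zero_apply] at hs
        simp only [Matrix.mul_apply, transpose_apply, of_apply, fun i => congrFun hc i,
          ← Finset.mul_sum, hs, mul_zero, Pi.zero_apply]
      simp [hy]
    · have h := hcond (d k) hd ⟨_, hne k, heig k⟩ ((Uᵀ * of e) k)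
      simp only [add_mulVec, sub_mulVec, smul_mulVec, one_mulVec, dotProduct_add,
        dotProduct_sub, dotProduct_smul, smul_eq_mul] at h
      linarith
  calc ∑ i, e i ⬝ᵥ F *ᵥ e i - ∑ i, ∑ j, L i j * (e i ⬝ᵥ H *ᵥ e j)
      = ∑ k, ((Uᵀ * of e) k ⬝ᵥ F *ᵥ (Uᵀ * of e) k
        - d k * ((Uᵀ * of e) k ⬝ᵥ H *ᵥ (Uᵀ * of e) k)) := by
        rw [Finset.sum_sub_distrib, ← hHsum, ← hsq F]
        rfl
    _ ≤ ∑ k, -ρ * ((Uᵀ * of e) k ⬝ᵥ (Uᵀ * of e) k) :=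
        Finset.sum_le_sum fun k _ => hterm k
    _ = -ρ * ∑ i, e i ⬝ᵥ e i := by rw [hnorm, Finset.mul_sum]
end

section
/- Let M be a real symmetric N×N matrix and let F and H be real symmetric n×n matrices such that F − μ·H is negative definite for every eigenvalue μ of M. Then the Kronecker expression I_N ⊗ F − M ⊗ H is a negative definite (Nn)×(Nn) matrix. -/
open Matrix Kronecker

/-- A real (symmetric) matrix is negative definite if its quadratic form is negative
on all nonzero vectors. -/
def IsNegDef {k : Type*} [Fintype k] (A : Matrix k k ℝ) : Prop :=
  ∀ x : k → ℝ, x ≠ 0 → x ⬝ᵥ A *ᵥ x < 0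

/-- Negative definiteness is preserved by an injective congruence. -/
theorem IsNegDef.transpose_mul_mul {k l : Type*} [Fintype k] [Fintype l] {A : Matrix k k ℝ}
    (hA : IsNegDef A) (B : Matrix k l ℝ) (hB : Function.Injective B.mulVec) :
    IsNegDef (Bᵀ * A * B) := by
  intro x hx
  have hBx : B *ᵥ x ≠ 0 := fun h => hx (hB (by simpa using h))
  have key := hA _ hBx
  rwa [← mulVec_mulVec, ← mulVec_mulVec, dotProduct_mulVec, vecMul_transpose]

/-- The quadratic form of `1 ⊗ F - diagonal d ⊗ H` splits over the blocks `F - d i • H`. -/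
theorem dotProduct_one_kronecker_sub_diagonal_kronecker_mulVec {k l : Type*} [Fintype k]
    [DecidableEq k] [Fintype l] (d : k → ℝ) (F H : Matrix l l ℝ) (x : k × l → ℝ) :
    x ⬝ᵥ ((1 : Matrix k k ℝ) ⊗ₖ F - diagonal d ⊗ₖ H) *ᵥ x =
      ∑ i, (fun a => x (i, a)) ⬝ᵥ (F - d i • H) *ᵥ fun a => x (i, a) := by
  simp only [dotProduct, mulVec, Fintype.sum_prod_type, Matrix.sub_apply, kronecker_apply,
    Matrix.smul_apply, smul_eq_mul, one_apply, diagonal_apply]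
  refine Finset.sum_congr rfl fun i _ => Finset.sum_congr rfl fun a _ => ?_
  rw [Finset.sum_eq_single i]
  · simp
  · intro j _ hj
    simp [hj.symm]
  · simp

theorem isNegDef_one_kronecker_sub_diagonal_kronecker {k l : Type*} [Fintype k] [DecidableEq k]
    [Fintype l] (d : k → ℝ) (F H : Matrix l l ℝ) (h : ∀ i, IsNegDef (F - d i • H)) :
    IsNegDef ((1 : Matrix k k ℝ) ⊗ₖ F - diagonal d ⊗ₖ H) := by
  intro x hx
  rw [dotProduct_one_kronecker_sub_diagonal_kronecker_mulVec]
  obtain ⟨⟨i, a⟩, hia⟩ := Function.ne_iff.mp hx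
  refine Finset.sum_neg' (fun j _ => ?_) ⟨i, Finset.mem_univ i, h i _ fun h0 => hia (congrFun h0 a)⟩
  by_cases hj : (fun a => x (j, a)) = 0
  · simp [hj]
  · exact (h j _ hj).le

/-- If `M` is a real symmetric `N × N` matrix and `F`, `H` are real symmetric `n × n`
matrices such that `F − μ·H` is negative definite for every eigenvalue `μ` of `M`,
then `I_N ⊗ F − M ⊗ H` is negative definite. -/
theorem stmt_7 {N n : ℕ} (M : Matrix (Fin N) (Fin N) ℝ) (hM : M.IsSymm)
    (F H : Matrix (Fin n) (Fin n) ℝ) (hF : F.IsSymm) (hH : H.IsSymm)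
    (hcond : ∀ μ : ℝ, (∃ v : Fin N → ℝ, v ≠ 0 ∧ M *ᵥ v = μ • v) →
      IsNegDef (F - μ • H)) :
    IsNegDef ((1 : Matrix (Fin N) (Fin N) ℝ) ⊗ₖ F - M ⊗ₖ H) := by
  have hM' : M.IsHermitian := by rwa [IsHermitian, conjTranspose_eq_transpose_of_trivial]
  set U : Matrix (Fin N) (Fin N) ℝ := hM'.eigenvectorUnitary.val
  have hUU : U * Uᵀ = 1 := by
    simpa [star_eq_conjTranspose] using Unitary.coe_mul_star_self hM'.eigenvectorUnitary
  have hspec : M = U * diagonal hM'.eigenvalues * Uᵀ := by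
    simpa [Unitary.conjStarAlgAut_apply, star_eq_conjTranspose, Function.comp_def] using
      hM'.spectral_theorem
  have hdiag := isNegDef_one_kronecker_sub_diagonal_kronecker hM'.eigenvalues F H fun i =>
    hcond _ ⟨hM'.eigenvectorBasis i,
      fun h => hM'.eigenvectorBasis.orthonormal.ne_zero i (by ext j; exact congrFun h j),
      hM'.mulVec_eigenvectorBasis i⟩
  have hinj : Function.Injective (Uᵀ ⊗ₖ (1 : Matrix (Fin n) (Fin n) ℝ)).mulVec := by
    refine Function.LeftInverse.injective (g := (U ⊗ₖ (1 : Matrix (Fin n) (Fin n) ℝ)).mulVec) ?_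
    intro x
    rw [mulVec_mulVec, ← mul_kronecker_mul, hUU, one_mul, one_kronecker_one, one_mulVec]
  have htr : (Uᵀ ⊗ₖ (1 : Matrix (Fin n) (Fin n) ℝ))ᵀ = U ⊗ₖ 1 := by
    rw [← kroneckerMap_transpose, transpose_transpose, transpose_one]
  have hcongr := hdiag.transpose_mul_mul _ hinj
  rwa [htr, mul_sub, sub_mul, ← mul_kronecker_mul, ← mul_kronecker_mul, ← mul_kronecker_mul,
    ← mul_kronecker_mul, ← hspec, mul_one, hUU, one_mul, one_mul, mul_one, mul_one] at hcongr
end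

section
/- Let L = [l_{ij}] be the Laplacian of a connected undirected graph on N nodes (real symmetric positive semidefinite, zero row sums, simple zero eigenvalue), H an n×n real matrix with symmetric part H⁽ˢ⁾ = (H+Hᵀ)/2, f : ℝ^n → ℝ^n satisfying the QUAD condition with symmetric positive semidefinite matrix F, G : ℝ^n → ℝ^{n×m}, and γ_1, …, γ_N ∈ ℝ^m with bounded uncertainties with bound γ_cᵀΓγ_c. Suppose ρ > 0 is such that F − μ_i·H⁽ˢ⁾ + ρ·I_n is negative definite for every nonzero eigenvalue μ_i of L, and let β > 0. Let x_1, …, x_N : ℝ → ℝ^n be differentiable functions satisfying ẋ_i(t) = f(x_i(t)) + G(x_i(t))γ_i − Σ_{j=1}^N l_{ij} H x_j(t) for all t, and set e_i(t) = x_i(t) − (1/N)Σ_{j=1}^N x_j(t) and V(t) = (1/2)Σ_{i=1}^N ‖e_i(t)‖². Then for all t, the derivative of V satisfies V̇(t) ≤ −(ρ − β/2)·Σ_{i=1}^N ‖e_i(t)‖² + (N/(2β))·γ_cᵀΓγ_c. -/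
open Matrix

/-- If `M = U diag(c) Uᵀ`, then the double sum of `M i j * (e i)ᵀ A (e j)` decouples in the
coordinates `Σ i, U i k • e i`. -/
theorem sum_mul_dotProduct_mulVec_eq {ι κ α : Type*} [Fintype ι] [Fintype κ] [Fintype α]
    (M : Matrix ι ι ℝ) (U : Matrix ι κ ℝ) (c : κ → ℝ)
    (hM : ∀ i j, M i j = ∑ k, c k * (U i k * U j k))
    (A : Matrix α α ℝ) (e : ι → α → ℝ) :
    ∑ i, ∑ j, M i j * (e i ⬝ᵥ A *ᵥ e j) =
      ∑ k, c k * ((∑ i, U i k • e i) ⬝ᵥ A *ᵥ (∑ i, U i k • e i)) := by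
  have h : ∀ k, (∑ i, U i k • e i) ⬝ᵥ A *ᵥ (∑ i, U i k • e i) =
      ∑ i, ∑ j, U i k * U j k * (e i ⬝ᵥ A *ᵥ e j) := by
    intro k
    simp only [mulVec_sum, sum_dotProduct, dotProduct_sum, mulVec_smul, smul_dotProduct,
      dotProduct_smul, smul_eq_mul, Finset.mul_sum]
    rw [Finset.sum_comm]
    exact Finset.sum_congr rfl fun i _ => Finset.sum_congr rfl fun j _ => by ring
  simp only [h, hM, Finset.sum_mul, Finset.mul_sum]
  conv_rhs => rw [Finset.sum_comm]
  refine Finset.sum_congr rfl fun i _ => ?_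
  rw [Finset.sum_comm]
  exact Finset.sum_congr rfl fun k _ => Finset.sum_congr rfl fun j _ => by ring

/-- Young's inequality for the dot product. -/
theorem dotProduct_le_young {α : Type*} [Fintype α] (a b : α → ℝ) {β : ℝ} (hβ : 0 < β) :
    a ⬝ᵥ b ≤ β / 2 * (a ⬝ᵥ a) + 1 / (2 * β) * (b ⬝ᵥ b) := by
  simp only [dotProduct, Finset.mul_sum, ← Finset.sum_add_distrib]
  refine Finset.sum_le_sum fun i _ => ?_
  have h : β / 2 * (a i * a i) + 1 / (2 * β) * (b i * b i) - a i * b i =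
      (β * a i - b i) ^ 2 / (2 * β) := by
    field_simp
    ring
  have : 0 ≤ (β * a i - b i) ^ 2 / (2 * β) := by positivity
  linarith

theorem dotProduct_symmPart_mulVec {α : Type*} [Fintype α] (H : Matrix α α ℝ) (y : α → ℝ) :
    y ⬝ᵥ ((1 / 2 : ℝ) • (H + Hᵀ)) *ᵥ y = y ⬝ᵥ H *ᵥ y := by
  have h : y ⬝ᵥ Hᵀ *ᵥ y = y ⬝ᵥ H *ᵥ y := by
    rw [mulVec_transpose, dotProduct_comm, dotProduct_mulVec]
  rw [smul_mulVec, dotProduct_smul, add_mulVec, dotProduct_add, h, smul_eq_mul]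
  ring

/-- The dissipation inequality on the subspace orthogonal to synchronization: the mode-wise
negative definiteness controls the coupled quadratic form of the deviations. -/
theorem sum_quadForm_le_of_isNegDef {N n : ℕ}
    (L : Matrix (Fin N) (Fin N) ℝ) (hL : L.IsHermitian)
    (hker : ∀ v : Fin N → ℝ, L *ᵥ v = 0 → ∃ c : ℝ, v = fun _ => c)
    (H F : Matrix (Fin n) (Fin n) ℝ) (ρ : ℝ)
    (hcond : ∀ μ : ℝ, μ ≠ 0 → (∃ v : Fin N → ℝ, v ≠ 0 ∧ L *ᵥ v = μ • v) →
      IsNegDef (F - μ • ((1 / 2 : ℝ) • (H + Hᵀ)) + ρ • (1 : Matrix (Fin n) (Fin n) ℝ)))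
    (e : Fin N → Fin n → ℝ) (he : ∑ i, e i = 0) :
    ∑ i, e i ⬝ᵥ F *ᵥ e i - ∑ i, ∑ j, L i j * (e i ⬝ᵥ H *ᵥ e j) ≤ -ρ * ∑ i, e i ⬝ᵥ e i := by
  set U : Matrix (Fin N) (Fin N) ℝ := hL.eigenvectorUnitary.1 with hU
  have hLU : ∀ i j, L i j = ∑ k, hL.eigenvalues k * (U i k * U j k) := by
    intro i j
    have h := congrFun (congrFun hL.spectral_theorem i) j
    rw [h, Unitary.conjStarAlgAut_apply, mul_apply]
    refine Finset.sum_congr rfl fun k _ => ?_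
    simp [mul_diagonal, star_apply, hU]
    ring
  have hone : ∀ i j, (1 : Matrix (Fin N) (Fin N) ℝ) i j = ∑ k, 1 * (U i k * U j k) := by
    intro i j
    have h : U * star U = 1 := Unitary.coe_mul_star_self hL.eigenvectorUnitary
    rw [← h, mul_apply]
    simp [star_apply]
  have hdiag : ∀ A : Matrix (Fin n) (Fin n) ℝ, ∑ i, e i ⬝ᵥ A *ᵥ e i =
      ∑ k, ((∑ i, U i k • e i) ⬝ᵥ A *ᵥ (∑ i, U i k • e i)) := by
    intro A
    have h := sum_mul_dotProduct_mulVec_eq 1 U (fun _ => 1) hone A e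
    simpa [one_apply] using h
  have hid : ∑ i, e i ⬝ᵥ e i = ∑ k, ((∑ i, U i k • e i) ⬝ᵥ (∑ i, U i k • e i)) := by
    simpa using hdiag 1
  rw [hdiag F, hid, sum_mul_dotProduct_mulVec_eq L U _ hLU H e, Finset.mul_sum,
    ← Finset.sum_sub_distrib]
  refine Finset.sum_le_sum fun k _ => ?_
  have heig : L *ᵥ (fun i => U i k) = hL.eigenvalues k • (fun i => U i k) :=
    hL.mulVec_eigenvectorBasis k
  have hne : (fun i => U i k) ≠ 0 := by
    intro h0
    have h : star U * U = 1 := Unitary.coe_star_mul_self hL.eigenvectorUnitary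
    have h1 := congrFun (congrFun h k) k
    rw [mul_apply, one_apply_eq] at h1
    simp [fun i => congrFun h0 i] at h1
  by_cases hμ : hL.eigenvalues k = 0
  · obtain ⟨c, hc⟩ := hker _ (by rw [heig, hμ, zero_smul])
    have hy : ∑ i, U i k • e i = 0 := by
      simp only [fun i => congrFun hc i, ← Finset.smul_sum, he, smul_zero]
    simp [hy]
  · generalize ∑ i, U i k • e i = y
    by_cases hy : y = 0
    · simp [hy]
    · have h := hcond _ hμ ⟨_, hne, heig⟩ y hy
      rw [add_mulVec, sub_mulVec, dotProduct_add, dotProduct_sub, smul_mulVec, dotProduct_smul,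
        dotProduct_symmPart_mulVec, smul_mulVec, dotProduct_smul, one_mulVec, smul_eq_mul,
        smul_eq_mul] at h
      linarith

theorem HasDerivAt.dotProduct_self {α : Type*} [Fintype α] {u : ℝ → α → ℝ} {u' : α → ℝ} {t : ℝ}
    (hu : HasDerivAt u u' t) :
    HasDerivAt (fun s => u s ⬝ᵥ u s) (2 * (u t ⬝ᵥ u')) t := by
  have h := HasDerivAt.fun_sum (u := Finset.univ) fun a _ =>
    (hasDerivAt_pi.1 hu a).mul (hasDerivAt_pi.1 hu a)
  refine h.congr_deriv ?_
  rw [dotProduct, Finset.mul_sum]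
  exact Finset.sum_congr rfl fun a _ => by ring

/-- Lyapunov derivative estimate for the open-loop mismatched network: with
`V(t) = (1/2)Σᵢ‖eᵢ(t)‖²` and `eᵢ = xᵢ − x̄`, under the QUAD condition, bounded
uncertainties, and `F − μᵢH⁽ˢ⁾ + ρI ≺ 0` for all nonzero eigenvalues `μᵢ` of the
connected Laplacian `L`, we have
`V̇(t) ≤ −(ρ − β/2)·Σᵢ‖eᵢ(t)‖² + (N/(2β))·γ_cᵀΓγ_c`. -/
theorem stmt_8 {N n m : ℕ}
    (L : Matrix (Fin N) (Fin N) ℝ) (hL : L.PosSemidef)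
    (hrow : ∀ i, ∑ j, L i j = 0)
    (hker : ∀ v : Fin N → ℝ, L *ᵥ v = 0 ↔ ∃ c : ℝ, v = fun _ => c)
    (H : Matrix (Fin n) (Fin n) ℝ)
    (f : (Fin n → ℝ) → (Fin n → ℝ))
    (F : Matrix (Fin n) (Fin n) ℝ) (hF : F.PosSemidef)
    (hquad : ∀ x y : Fin n → ℝ, (x - y) ⬝ᵥ (f x - f y) ≤ (x - y) ⬝ᵥ F *ᵥ (x - y))
    (G : (Fin n → ℝ) → Matrix (Fin n) (Fin m) ℝ)
    (γ : Fin N → (Fin m → ℝ)) (Γ : Matrix (Fin m) (Fin m) ℝ) (hΓ : Γ.PosSemidef)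
    (γc : Fin m → ℝ)
    (hbound : ∀ (x : Fin n → ℝ) (i : Fin N),
      γ i ⬝ᵥ ((G x)ᵀ * G x) *ᵥ γ i ≤ γc ⬝ᵥ Γ *ᵥ γc)
    (ρ β : ℝ) (hρ : 0 < ρ) (hβ : 0 < β)
    (hcond : ∀ μ : ℝ, μ ≠ 0 → (∃ v : Fin N → ℝ, v ≠ 0 ∧ L *ᵥ v = μ • v) →
      IsNegDef (F - μ • ((1 / 2 : ℝ) • (H + Hᵀ)) + ρ • (1 : Matrix (Fin n) (Fin n) ℝ)))
    (x : Fin N → ℝ → (Fin n → ℝ))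
    (hode : ∀ (i : Fin N) (t : ℝ), HasDerivAt (x i)
      (f (x i t) + (G (x i t)) *ᵥ γ i - ∑ j, L i j • (H *ᵥ x j t)) t)
    -- the deviations from the average trajectory
    (e : Fin N → ℝ → (Fin n → ℝ))
    (he : ∀ i t, e i t = x i t - (1 / (N : ℝ)) • ∑ j, x j t)
    -- the Lyapunov function
    (V : ℝ → ℝ) (hV : ∀ t, V t = (1 / 2 : ℝ) * ∑ i, (e i t) ⬝ᵥ (e i t)) :
    ∀ t : ℝ, deriv V t ≤
      -(ρ - β / 2) * ∑ i, (e i t) ⬝ᵥ (e i t)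
        + ((N : ℝ) / (2 * β)) * (γc ⬝ᵥ Γ *ᵥ γc) := by
  intro t
  set d : Fin N → Fin n → ℝ := fun i =>
    f (x i t) + (G (x i t)) *ᵥ γ i - ∑ j, L i j • (H *ᵥ x j t) with hd
  set a : Fin n → ℝ := (1 / (N : ℝ)) • ∑ j, x j t with ha
  have hesum : ∑ i, e i t = 0 := by
    rcases Nat.eq_zero_or_pos N with rfl | hN
    · simp
    · have : (N : ℝ) ≠ 0 := by positivity
      simp only [he, Finset.sum_sub_distrib, Finset.sum_const, Finset.card_univ, Fintype.card_fin]
      rw [← Nat.cast_smul_eq_nsmul ℝ, smul_smul, mul_one_div_cancel this, one_smul, sub_self]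
  have hort : ∀ w : Fin n → ℝ, ∑ i, e i t ⬝ᵥ w = 0 := fun w => by
    rw [← sum_dotProduct, hesum, zero_dotProduct]
  have hderiv : HasDerivAt V (∑ i, e i t ⬝ᵥ d i) t := by
    have hei : ∀ i, HasDerivAt (e i) (d i - (1 / (N : ℝ)) • ∑ j, d j) t := fun i => by
      rw [funext (he i)]
      exact (hode i t).sub
        ((HasDerivAt.fun_sum fun j _ => hode j t).const_smul (1 / (N : ℝ)))
    rw [funext hV]
    refine ((HasDerivAt.fun_sum fun i _ => (hei i).dotProduct_self).const_mul
      (1 / 2 : ℝ)).congr_deriv ?_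
    rw [← Finset.mul_sum]
    simp only [dotProduct_sub, Finset.sum_sub_distrib, hort]
    ring
  rw [hderiv.deriv]
  have hcoup : ∀ i, ∑ j, L i j • (H *ᵥ x j t) = ∑ j, L i j • (H *ᵥ e j t) := fun i => by
    simp only [he, mulVec_sub, smul_sub, Finset.sum_sub_distrib, ← Finset.sum_smul, hrow i,
      zero_smul, sub_zero]
  have hterm : ∀ i, e i t ⬝ᵥ d i ≤ e i t ⬝ᵥ F *ᵥ e i t + e i t ⬝ᵥ f a
      + (β / 2 * (e i t ⬝ᵥ e i t) + 1 / (2 * β) * (γc ⬝ᵥ Γ *ᵥ γc))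
      - ∑ j, L i j * (e i t ⬝ᵥ H *ᵥ e j t) := fun i => by
    have hq : e i t ⬝ᵥ (f (x i t) - f a) ≤ e i t ⬝ᵥ F *ᵥ e i t := by
      rw [he i t]
      exact hquad (x i t) a
    have hy := dotProduct_le_young (e i t) (G (x i t) *ᵥ γ i) hβ
    have hb : (G (x i t) *ᵥ γ i) ⬝ᵥ (G (x i t) *ᵥ γ i) ≤ γc ⬝ᵥ Γ *ᵥ γc := by
      refine le_of_eq_of_le ?_ (hbound (x i t) i)
      rw [← mulVec_mulVec, mulVec_transpose, dotProduct_comm (γ i), ← dotProduct_mulVec]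
    have hb' := mul_le_mul_of_nonneg_left hb (by positivity : 0 ≤ 1 / (2 * β))
    rw [dotProduct_sub] at hq
    simp only [hd, hcoup, dotProduct_sub, dotProduct_add, dotProduct_sum, dotProduct_smul,
      smul_eq_mul]
    linarith
  have hspec := sum_quadForm_le_of_isNegDef L hL.isHermitian (fun v => (hker v).1) H F ρ hcond
    (fun i => e i t) hesum
  have hsum := Finset.sum_le_sum fun i (_ : i ∈ Finset.univ) => hterm i
  simp only [Finset.sum_sub_distrib, Finset.sum_add_distrib, hort, ← Finset.mul_sum,
    Finset.sum_const, Finset.card_univ, Fintype.card_fin, nsmul_eq_mul] at hsum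
  have hN : (N : ℝ) / (2 * β) * (γc ⬝ᵥ Γ *ᵥ γc) =
      N * (1 / (2 * β) * (γc ⬝ᵥ Γ *ᵥ γc)) := by ring
  rw [hN]
  linarith
end
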